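/- For all subsets C₁ ⊆ U₁, C₂ ⊆ U₂ and all ε ∈ (0,1]^{I₁}, η ∈ (0,1]^{I₂}, one has (C₁ × C₂)_{εη} ⊆ (C₁)_ε × (C₂)_η, where (εη)_{(i,j)} = ε_i·η_j and the left-hand enlargement is taken with respect to the product cover (U_i × V_j)_{(i,j)∈I₁×I₂}. Consequently, if 𝓒₁ and 𝓒₂ are polar enlargeable families of closed subsets of U₁ and U₂ (with respect to the covers (U_i) and (V_j)), then (𝓒₁ × 𝓒₂)°° is a polar enlargeable family of closed subsets of U₁ × U₂ with respect to the product cover. -/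

import Mathlib

open Set Metric

section Defs

variable {X : Type*} [MetricSpace X]

/-- `V` is open in the subspace topology of `U`. -/
def IsOpenIn (U V : Set X) : Prop := ∃ W, IsOpen W ∧ V = W ∩ U

/-- `C` is closed in the subspace topology of `U`. -/
def IsClosedIn (U C : Set X) : Prop := ∃ F, IsClosed F ∧ C = F ∩ U

/-- Closure of `C` in the subspace topology of `U` (for `C ⊆ U`). -/
def closureIn (U C : Set X) : Set X := closure C ∩ U

/-- Interior of `S` in the subspace topology of `U`. -/
def interiorIn (U S : Set X) : Set X := U \ closure (U \ S)

/-- Polar of a family `𝓞` of open subsets of `U`:  closed subsets of `U` whose intersection with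
every member of `𝓞` has compact closure in `U`. -/
def polarO (U : Set X) (𝓞 : Set (Set X)) : Set (Set X) :=
  {C | IsClosedIn U C ∧ ∀ W ∈ 𝓞, IsCompact (closureIn U (C ∩ W))}

/-- Polar of a family `𝓒` of closed subsets of `U`: open subsets of `U` whose intersection with
every member of `𝓒` has compact closure in `U`. -/
def polarC (U : Set X) (𝓒 : Set (Set X)) : Set (Set X) :=
  {V | IsOpenIn U V ∧ ∀ C ∈ 𝓒, IsCompact (closureIn U (V ∩ C))}

/-- `𝓞_𝓒`: the family of relative interiors of members of `𝓒`. -/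
def oFam (U : Set X) (𝓒 : Set (Set X)) : Set (Set X) := interiorIn U '' 𝓒

/-- `𝓒_𝓞`: the family of relative closures of members of `𝓞`. -/
def cFam (U : Set X) (𝓞 : Set (Set X)) : Set (Set X) := closureIn U '' 𝓞

/-- Uniform `ε`-enlargement of `C ⊆ U`:
`C_{uε} = {x ∈ U : ∃ y ∈ C, d(x,y) ≤ min(ε, d(y,M∖U)·(1−e^{−ε})/2)}`, where the distance to the
(possibly empty) complement of `U` is taken in `[0,∞]`. -/
def uEnl (U C : Set X) (ε : ℝ) : Set X :=
  {x | x ∈ U ∧ ∃ y ∈ C, dist x y ≤ ε ∧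
    ENNReal.ofReal (dist x y) ≤ EMetric.infEdist y Uᶜ * ENNReal.ofReal ((1 - Real.exp (-ε)) / 2)}

/-- A family of closed subsets of `U` is uniformly enlargeable if each member has some uniform
`ε`-enlargement in the family. -/
def UniformlyEnlargeable (U : Set X) (𝓒 : Set (Set X)) : Prop :=
  ∀ C ∈ 𝓒, ∃ ε : ℝ, 0 < ε ∧ uEnl U C ε ∈ 𝓒

/-- The cover-dependent `ε`-enlargement `C_ε = ⋃ᵢ cl(Uᵢ) ∩ (cl(Uᵢ) ∩ C)_{uεᵢ}`. -/
def coverEnl {I : Type*} (Ui : I → Set X) (U C : Set X) (ε : I → ℝ) : Set X :=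
  ⋃ i, closure (Ui i) ∩ uEnl U (closure (Ui i) ∩ C) (ε i)

/-- The cover-dependent enlargement `C_{wε} = ⋃ᵢ (cl(Uᵢ) ∩ C)_{uεᵢ}`. -/
def coverWEnl {I : Type*} (Ui : I → Set X) (U C : Set X) (ε : I → ℝ) : Set X :=
  ⋃ i, uEnl U (closure (Ui i) ∩ C) (ε i)

/-- A family of closed subsets of `U` is enlargeable with respect to the cover `Ui` if each
member has some cover-enlargement in the family. -/
def Enlargeable {I : Type*} (Ui : I → Set X) (U : Set X) (𝓒 : Set (Set X)) : Prop :=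
  ∀ C ∈ 𝓒, ∃ ε : I → ℝ, (∀ i, 0 < ε i) ∧ coverEnl Ui U C ε ∈ 𝓒

/-- A cover of `U` by open sets with compact closures contained in `U`, locally finite in `U`. -/
structure GoodCover {I : Type*} (Ui : I → Set X) (U : Set X) : Prop where
  isOpen : ∀ i, IsOpen (Ui i)
  covers : U ⊆ ⋃ i, Ui i
  compactCl : ∀ i, IsCompact (closure (Ui i))
  clSubset : ∀ i, closure (Ui i) ⊆ U
  locFin : ∀ x ∈ U, ∃ t ∈ nhds x, {i | (closure (Ui i) ∩ t).Nonempty}.Finite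

/-- `δ(t) = ln((1+e^{−t})/(3e^{−t}−1))`. -/
noncomputable def deltaFn (t : ℝ) : ℝ :=
  Real.log ((1 + Real.exp (-t)) / (3 * Real.exp (-t) - 1))

end Defs

section Helpers

variable {X : Type*} [MetricSpace X]

theorem uEnl_mono {U C D : Set X} (h : C ⊆ D) {ε δ : ℝ} (hε : ε ≤ δ) :
    uEnl U C ε ⊆ uEnl U D δ := by
  rintro x ⟨hx, y, hy, h1, h2⟩
  refine ⟨hx, y, h hy, h1.trans hε, h2.trans ?_⟩
  have : Real.exp (-δ) ≤ Real.exp (-ε) := Real.exp_le_exp.2 (by linarith)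
  gcongr

theorem coverEnl_mono {I : Type*} {Ui : I → Set X} {U C D : Set X} (h : C ⊆ D) {ε δ : I → ℝ}
    (hε : ∀ i, ε i ≤ δ i) : coverEnl Ui U C ε ⊆ coverEnl Ui U D δ := by
  unfold coverEnl
  exact iUnion_mono fun i => inter_subset_inter_right _
    (uEnl_mono (inter_subset_inter_right _ h) (hε i))

theorem closureIn_compact_mono {U A B : Set X} (h : A ⊆ B) (hB : IsCompact (closureIn U B)) :
    IsCompact (closureIn U A) := by
  have : closureIn U A = closureIn U B ∩ closure A := by
    ext x
    have := @closure_mono _ _ _ _ h x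
    simp only [closureIn, mem_inter_iff]
    tauto
  rw [this]
  exact hB.inter_right isClosed_closure

theorem compact_closureIn {U S : Set X}
    (h : ∀ u : ℕ → X, (∀ n, u n ∈ S) → ∃ a ∈ U, MapClusterPt a Filter.atTop u) :
    IsCompact (closureIn U S) := by
  apply IsSeqCompact.isCompact
  intro v hv
  have : ∀ n : ℕ, ∃ s ∈ S, dist (v n) s < 1 / ((n : ℝ) + 1) := fun n =>
    Metric.mem_closure_iff.1 (hv n).1 _ (by positivity)
  choose u hu hd using this
  obtain ⟨a, haU, ha⟩ := h u hu
  obtain ⟨φ, hφ, hlim⟩ := TopologicalSpace.FirstCountableTopology.tendsto_subseq ha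
  refine ⟨a, ⟨mem_closure_of_tendsto hlim (Filter.Eventually.of_forall fun n => hu _), haU⟩,
    φ, hφ, ?_⟩
  have h0 : Filter.Tendsto (fun n => dist ((u ∘ φ) n) ((v ∘ φ) n)) Filter.atTop (nhds 0) := by
    refine squeeze_zero (fun _ => dist_nonneg) (fun n => ?_)
      (tendsto_one_div_add_atTop_nhds_zero_nat.comp hφ.tendsto_atTop)
    rw [dist_comm]
    exact (hd (φ n)).le
  exact hlim.congr_dist h0

theorem polarO_mono {U C D : Set X} {O : Set (Set X)} (hD : D ∈ polarO U O) (hC : IsClosedIn U C)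
    (h : C ⊆ D) : C ∈ polarO U O :=
  ⟨hC, fun W hW => closureIn_compact_mono (inter_subset_inter_left _ h) (hD.2 W hW)⟩

theorem subset_bipolar {U : Set X} {P : Set (Set X)} (hP : ∀ C ∈ P, IsClosedIn U C) :
    P ⊆ polarO U (polarC U P) :=
  fun C hC => ⟨hP C hC, fun W hW => by rw [inter_comm]; exact hW.2 C hC⟩

theorem bipolar_bipolar {U : Set X} {P : Set (Set X)} (hP : ∀ C ∈ P, IsClosedIn U C) :
    polarO U (polarC U P) = polarO U (polarC U (polarO U (polarC U P))) := by
  apply Subset.antisymm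
  · exact subset_bipolar fun C hC => hC.1
  · rintro C ⟨hC, h⟩
    refine ⟨hC, fun W hW => h W ⟨hW.1, fun D hD => ?_⟩⟩
    rw [inter_comm]; exact hD.2 W hW

theorem isClosed_piece {U K L : Set X} (hL : IsCompact L) (hK : IsClosed K) (hKU : K ⊆ U) (ε : ℝ) :
    IsClosed (K ∩ uEnl U L ε) := by
  have hset : K ∩ uEnl U L ε = K ∩ Prod.fst '' {p : X × L | dist p.1 (p.2 : X) ≤ ε ∧
      ENNReal.ofReal (dist p.1 (p.2 : X)) ≤
        EMetric.infEdist (p.2 : X) Uᶜ * ENNReal.ofReal ((1 - Real.exp (-ε)) / 2)} := by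
    ext x
    constructor
    · rintro ⟨hx, -, y, hy, h1, h2⟩
      exact ⟨hx, (x, ⟨y, hy⟩), ⟨h1, h2⟩, rfl⟩
    · rintro ⟨hx, ⟨x', y⟩, ⟨h1, h2⟩, rfl⟩
      exact ⟨hx, hKU hx, y, y.2, h1, h2⟩
  rw [hset]
  refine hK.inter ?_
  haveI : CompactSpace L := isCompact_iff_compactSpace.1 hL
  apply isClosedMap_fst_of_compactSpace
  apply IsClosed.inter
  · exact isClosed_le (f := fun p : X × L => dist p.1 (p.2 : X)) (by fun_prop) continuous_const
  · refine isClosed_le (ENNReal.continuous_ofReal.comp (by fun_prop)) ?_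
    refine (ENNReal.continuous_mul_const ENNReal.ofReal_ne_top).comp ?_
    exact EMetric.continuous_infEdist.comp (by fun_prop)

theorem isClosedIn_coverEnl {I : Type*} {Ui : I → Set X} {U C : Set X}
    (hc : ∀ i, IsCompact (closure (Ui i))) (hs : ∀ i, closure (Ui i) ⊆ U)
    (hl : ∀ x ∈ U, ∃ t ∈ nhds x, {i | (closure (Ui i) ∩ t).Nonempty}.Finite)
    (hC : IsClosedIn U C) (ε : I → ℝ) : IsClosedIn U (coverEnl Ui U C ε) := by
  obtain ⟨F, hF, rfl⟩ := hC
  have hp : ∀ i, IsClosed (closure (Ui i) ∩ uEnl U (closure (Ui i) ∩ (F ∩ U)) (ε i)) := by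
    intro i
    refine isClosed_piece ?_ isClosed_closure (hs i) _
    have : closure (Ui i) ∩ (F ∩ U) = closure (Ui i) ∩ F := by
      ext x
      have := @hs i x
      simp only [mem_inter_iff]; tauto
    rw [this]
    exact (hc i).inter_right hF
  refine ⟨closure (coverEnl Ui U (F ∩ U) ε), isClosed_closure, ?_⟩
  apply Subset.antisymm
  · intro x hx
    refine ⟨subset_closure hx, ?_⟩
    obtain ⟨i, hi⟩ := mem_iUnion.1 hx
    exact hs i hi.1
  · rintro x ⟨hx, hxU⟩
    obtain ⟨t, ht, hfin⟩ := hl x hxU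
    have h1 : IsClosed (⋃ i ∈ {i | (closure (Ui i) ∩ t).Nonempty},
        closure (Ui i) ∩ uEnl U (closure (Ui i) ∩ (F ∩ U)) (ε i)) :=
      hfin.isClosed_biUnion fun i _ => hp i
    have h2 : x ∈ closure (coverEnl Ui U (F ∩ U) ε ∩ t) := by
      rw [mem_closure_iff_nhds] at hx ⊢
      intro s hs'
      obtain ⟨y, ⟨hy1, hy2⟩, hy3⟩ := hx (s ∩ t) (Filter.inter_mem hs' ht)
      exact ⟨y, hy1, hy3, hy2⟩
    have h3 := closure_minimal (t := ⋃ i ∈ {i | (closure (Ui i) ∩ t).Nonempty},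
        closure (Ui i) ∩ uEnl U (closure (Ui i) ∩ (F ∩ U)) (ε i)) (by
      rintro y ⟨hy, hyt⟩
      obtain ⟨i, hi⟩ := mem_iUnion.1 hy
      exact mem_biUnion (show i ∈ {i | (closure (Ui i) ∩ t).Nonempty} from ⟨y, hi.1, hyt⟩) hi) h1 h2
    obtain ⟨i, -, hi⟩ := mem_iUnion₂.1 h3
    exact mem_iUnion.2 ⟨i, hi⟩

theorem proj_mem {Z : Type*} [MetricSpace Z] [ProperSpace Z] {U : Set Z} (hU : IsOpen U)
    {U₁ : Set X} (hU₁ : IsOpen U₁) (π : Z → X) (hπ : ∀ a b, dist (π a) (π b) ≤ dist a b)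
    (hπU : ∀ z ∈ U, π z ∈ U₁) {P : Set (Set Z)} {𝓒 : Set (Set X)}
    (hP : ∀ S ∈ P, ∃ F₁ ∈ 𝓒, ∀ z ∈ S, π z ∈ F₁) {F : Set Z}
    (hF : F ∈ polarO U (polarC U P)) :
    closureIn U₁ (π '' F) ∈ polarO U₁ (polarC U₁ 𝓒) := by
  have hπc : Continuous π := (LipschitzWith.of_dist_le_mul (K := 1) (by simpa using hπ)).continuous
  have hFU : F ⊆ U := by
    obtain ⟨⟨G, -, rfl⟩, -⟩ := hF
    exact inter_subset_right
  refine ⟨⟨_, isClosed_closure, rfl⟩, fun W hW => ?_⟩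
  obtain ⟨⟨O, hO, hWO⟩, hWC⟩ := hW
  have hWo : IsOpen W := hWO ▸ hO.inter hU₁
  have hWU : W ⊆ U₁ := hWO ▸ inter_subset_right
  suffices hk : IsCompact (closureIn U₁ (π '' F ∩ W)) by
    have : closureIn U₁ (closureIn U₁ (π '' F) ∩ W) ⊆ closureIn U₁ (π '' F ∩ W) := by
      refine inter_subset_inter_left _ (closure_minimal ?_ isClosed_closure)
      rintro x ⟨⟨hx, -⟩, hxW⟩
      exact hWo.closure_inter ⟨hx, hxW⟩
    have h2 : closureIn U₁ (closureIn U₁ (π '' F) ∩ W) = closureIn U₁ (π '' F ∩ W) := by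
      refine this.antisymm (inter_subset_inter_left _ (closure_mono ?_))
      rintro x ⟨hx, hxW⟩
      exact ⟨⟨subset_closure hx, hWU hxW⟩, hxW⟩
    rwa [h2]
  apply compact_closureIn
  intro u hu
  by_contra hno
  have : ∀ n, ∃ z ∈ F, π z = u n := fun n => (hu n).1
  choose z hzF hzu using this
  have hr : ∀ n : ℕ, ∃ r > 0, r ≤ 1 / ((n : ℝ) + 1) ∧ closedBall (z n) r ⊆ U ∩ π ⁻¹' W := by
    intro n
    have hmem : U ∩ π ⁻¹' W ∈ nhds (z n) :=
      (hU.inter (hWo.preimage hπc)).mem_nhds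
        ⟨hFU (hzF n), by rw [mem_preimage, hzu]; exact (hu n).2⟩
    obtain ⟨r, hr, hb⟩ := Metric.nhds_basis_closedBall.mem_iff.1 hmem
    exact ⟨min r (1 / ((n : ℝ) + 1)), lt_min hr (by positivity), min_le_right _ _,
      (closedBall_subset_closedBall (min_le_left _ _)).trans hb⟩
  choose r hr0 hr1 hrb using hr
  have hW'U : (⋃ n, ball (z n) (r n)) ⊆ U := iUnion_subset fun n =>
    ball_subset_closedBall.trans ((hrb n).trans inter_subset_left)
  have hW' : (⋃ n, ball (z n) (r n)) ∈ polarC U P := by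
    refine ⟨⟨_, isOpen_iUnion fun n => isOpen_ball, (inter_eq_left.2 hW'U).symm⟩, ?_⟩
    intro S hS
    obtain ⟨F₁, hF₁, hSF⟩ := hP S hS
    apply compact_closureIn
    intro p hp
    have : ∀ k, ∃ n, p k ∈ ball (z n) (r n) := fun k => mem_iUnion.1 (hp k).1
    choose n hn using this
    by_cases ht : Filter.Tendsto n Filter.atTop Filter.atTop
    · exfalso
      obtain ⟨a, ha, φ, hφ, hlim⟩ := (hWC F₁ hF₁).tendsto_subseq (x := fun k => π (p k))
        (fun k => by
          have h1 : π (p k) ∈ W := (hrb _ (ball_subset_closedBall (hn k))).2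
          exact ⟨subset_closure ⟨h1, hSF _ (hp k).2⟩, hWU h1⟩)
      have hnφ := ht.comp hφ.tendsto_atTop
      apply hno
      refine ⟨a, ha.2, MapClusterPt.of_comp hnφ (Filter.Tendsto.mapClusterPt ?_)⟩
      refine hlim.congr_dist ?_
      refine squeeze_zero (fun _ => dist_nonneg) (fun k => ?_)
        (tendsto_one_div_add_atTop_nhds_zero_nat.comp hnφ)
      have h1 := hn (φ k)
      rw [mem_ball] at h1
      have h2 := hπ (p (φ k)) (z (n (φ k)))
      rw [hzu] at h2
      exact h2.trans (h1.le.trans (hr1 _))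
    · rw [Filter.tendsto_atTop] at ht
      push Not at ht
      obtain ⟨N, hN⟩ := ht
      have hK : IsCompact (⋃ m ∈ Finset.range N, closedBall (z m) (r m)) :=
        (Finset.range N).isCompact_biUnion fun m _ => isCompact_closedBall _ _
      have hfr : ∃ᶠ k in Filter.atTop, p k ∈ ⋃ m ∈ Finset.range N, closedBall (z m) (r m) := by
        refine (Filter.not_eventually.1 hN).mono fun k hk => ?_
        exact mem_iUnion₂.2 ⟨n k, by simpa using hk, ball_subset_closedBall (hn k)⟩
      obtain ⟨a, ha, hcl⟩ := hK.exists_mapClusterPt_of_frequently hfr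
      obtain ⟨m, -, hm⟩ := mem_iUnion₂.1 ha
      exact ⟨a, (hrb m hm).1, hcl⟩
  obtain ⟨a, ha, φ, hφ, hlim⟩ := (hF.2 _ hW').tendsto_subseq (x := z) (fun k =>
    ⟨subset_closure ⟨hzF k, mem_iUnion.2 ⟨k, mem_ball_self (hr0 k)⟩⟩, hFU (hzF k)⟩)
  apply hno
  refine ⟨π a, hπU a ha.2, MapClusterPt.of_comp hφ.tendsto_atTop (Filter.Tendsto.mapClusterPt ?_)⟩
  have := (hπc.tendsto a).comp hlim
  refine this.congr fun k => ?_
  simp [hzu]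

theorem uEnl_proj {Z : Type*} [MetricSpace Z] {U C : Set Z} {U₁ C₁ : Set X} (π : Z → X)
    (hπ : ∀ a b, dist (π a) (π b) ≤ dist a b)
    (hπU : ∀ z ∈ U, π z ∈ U₁) (hC : ∀ z ∈ C, π z ∈ C₁)
    (hlift : ∀ z, ∀ x ∉ U₁, ∃ w ∉ U, edist z w = edist (π z) x) {ε δ : ℝ} (h : ε ≤ δ)
    {z : Z} (hz : z ∈ uEnl U C ε) : π z ∈ uEnl U₁ C₁ δ := by
  obtain ⟨hzU, y, hy, h1, h2⟩ := hz
  refine uEnl_mono (U := U₁) subset_rfl h ⟨hπU z hzU, π y, hC y hy, (hπ _ _).trans h1, ?_⟩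
  refine (ENNReal.ofReal_le_ofReal (hπ _ _)).trans (h2.trans ?_)
  gcongr
  refine EMetric.le_infEdist.2 fun x hx => ?_
  obtain ⟨w, hw, hwe⟩ := hlift y x hx
  rw [← hwe]
  exact EMetric.infEdist_le_edist_of_mem hw

end Helpers

theorem coverEnl_prod {X Y : Type*} [MetricSpace X] [MetricSpace Y]
    {I₁ I₂ : Type*} (U₁ : Set X) (U₂ : Set Y) (Ui : I₁ → Set X) (Vj : I₂ → Set Y)
    (C₁ : Set X) (C₂ : Set Y) 
    (ε : I₁ → ℝ) (η : I₂ → ℝ)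
    (hε : ∀ i, 0 < ε i ∧ ε i ≤ 1) (hη : ∀ j, 0 < η j ∧ η j ≤ 1) :
    coverEnl (fun p : I₁ × I₂ => (Ui p.1) ×ˢ (Vj p.2)) (U₁ ×ˢ U₂) (C₁ ×ˢ C₂)
            (fun p => ε p.1 * η p.2) ⊆
          (coverEnl Ui U₁ C₁ ε) ×ˢ (coverEnl Vj U₂ C₂ η) := by
  intro z hz
  obtain ⟨⟨i, j⟩, hz1, hz2⟩ := mem_iUnion.1 hz
  simp only [closure_prod_eq] at hz1 hz2
  refine ⟨mem_iUnion.2 ⟨i, hz1.1, ?_⟩, mem_iUnion.2 ⟨j, hz1.2, ?_⟩⟩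
  · refine uEnl_proj (C₁ := closure (Ui i) ∩ C₁) Prod.fst (fun a b => le_max_left _ _) (fun z hz => hz.1) 
      (fun z hz => ⟨hz.1.1, hz.2.1⟩) ?_ ?_ hz2
    · intro z x hx
      exact ⟨(x, z.2), fun h => hx h.1, by simp [Prod.edist_eq]⟩
    · exact mul_le_of_le_one_right (hε i).1.le (hη j).2
  · refine uEnl_proj (C₁ := closure (Vj j) ∩ C₂) Prod.snd (fun a b => le_max_right _ _) (fun z hz => hz.2) 
      (fun z hz => ⟨hz.1.2, hz.2.2⟩) ?_ ?_ hz2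
    · intro z x hx
      exact ⟨(z.1, x), fun h => hx h.2, by simp [Prod.edist_eq]⟩
    · exact mul_le_of_le_one_left (hη j).1.le (hε i).2

/-- cover enlargements of products, and products of polar enlargeable
families with respect to the product cover. -/
theorem stmt17 {X Y : Type*} [MetricSpace X] [ProperSpace X] [MetricSpace Y] [ProperSpace Y]
    {I₁ I₂ : Type*}
    (U₁ : Set X) (hU₁ : IsOpen U₁) (U₂ : Set Y) (hU₂ : IsOpen U₂)
    (Ui : I₁ → Set X) (hcov₁ : GoodCover Ui U₁)
    (Vj : I₂ → Set Y) (hcov₂ : GoodCover Vj U₂) :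
    (∀ (C₁ : Set X) (C₂ : Set Y), C₁ ⊆ U₁ → C₂ ⊆ U₂ →
      ∀ (ε : I₁ → ℝ) (η : I₂ → ℝ),
        (∀ i, 0 < ε i ∧ ε i ≤ 1) → (∀ j, 0 < η j ∧ η j ≤ 1) →
        coverEnl (fun p : I₁ × I₂ => (Ui p.1) ×ˢ (Vj p.2)) (U₁ ×ˢ U₂) (C₁ ×ˢ C₂)
            (fun p => ε p.1 * η p.2) ⊆
          (coverEnl Ui U₁ C₁ ε) ×ˢ (coverEnl Vj U₂ C₂ η)) ∧
    ∀ (𝓒₁ : Set (Set X)) (𝓒₂ : Set (Set Y)),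
      (∀ C ∈ 𝓒₁, IsClosedIn U₁ C) → 𝓒₁ = polarO U₁ (polarC U₁ 𝓒₁) →
        Enlargeable Ui U₁ 𝓒₁ →
      (∀ C ∈ 𝓒₂, IsClosedIn U₂ C) → 𝓒₂ = polarO U₂ (polarC U₂ 𝓒₂) →
        Enlargeable Vj U₂ 𝓒₂ →
      ((∀ F ∈ polarO (U₁ ×ˢ U₂)
            (polarC (U₁ ×ˢ U₂) {S | ∃ F₁ ∈ 𝓒₁, ∃ F₂ ∈ 𝓒₂, S = F₁ ×ˢ F₂}),
          IsClosedIn (U₁ ×ˢ U₂) F) ∧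
        Enlargeable (fun p : I₁ × I₂ => (Ui p.1) ×ˢ (Vj p.2)) (U₁ ×ˢ U₂)
          (polarO (U₁ ×ˢ U₂)
            (polarC (U₁ ×ˢ U₂) {S | ∃ F₁ ∈ 𝓒₁, ∃ F₂ ∈ 𝓒₂, S = F₁ ×ˢ F₂})) ∧
        polarO (U₁ ×ˢ U₂)
            (polarC (U₁ ×ˢ U₂) {S | ∃ F₁ ∈ 𝓒₁, ∃ F₂ ∈ 𝓒₂, S = F₁ ×ˢ F₂}) =
          polarO (U₁ ×ˢ U₂) (polarC (U₁ ×ˢ U₂)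
            (polarO (U₁ ×ˢ U₂)
              (polarC (U₁ ×ˢ U₂) {S | ∃ F₁ ∈ 𝓒₁, ∃ F₂ ∈ 𝓒₂, S = F₁ ×ˢ F₂})))) := by
  refine ⟨fun C₁ C₂ _ _ ε η hε hη => coverEnl_prod U₁ U₂ Ui Vj C₁ C₂ ε η hε hη, ?_⟩
  intro 𝓒₁ 𝓒₂ hc₁ hp₁ he₁ hc₂ hp₂ he₂
  have hPc : ∀ S ∈ {S : Set (X × Y) | ∃ F₁ ∈ 𝓒₁, ∃ F₂ ∈ 𝓒₂, S = F₁ ×ˢ F₂},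
      IsClosedIn (U₁ ×ˢ U₂) S := by
    rintro S ⟨F₁, hF₁, F₂, hF₂, rfl⟩
    obtain ⟨G₁, hG₁, rfl⟩ := hc₁ F₁ hF₁
    obtain ⟨G₂, hG₂, rfl⟩ := hc₂ F₂ hF₂
    exact ⟨G₁ ×ˢ G₂, hG₁.prod hG₂, prod_inter_prod.symm⟩
  refine ⟨fun F hF => hF.1, ?_, bipolar_bipolar hPc⟩
  intro F hF
  have hFU : F ⊆ U₁ ×ˢ U₂ := by
    obtain ⟨⟨G, -, rfl⟩, -⟩ := hF
    exact inter_subset_right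
  have h1 : closureIn U₁ (Prod.fst '' F) ∈ 𝓒₁ := by
    rw [hp₁]
    refine proj_mem (hU₁.prod hU₂) hU₁ Prod.fst (fun a b => le_max_left _ _)
      (fun z hz => hz.1) ?_ hF
    rintro S ⟨F₁, hF₁, F₂, hF₂, rfl⟩
    exact ⟨F₁, hF₁, fun z hz => hz.1⟩
  have h2 : closureIn U₂ (Prod.snd '' F) ∈ 𝓒₂ := by
    rw [hp₂]
    refine proj_mem (hU₁.prod hU₂) hU₂ Prod.snd (fun a b => le_max_right _ _)
      (fun z hz => hz.2) ?_ hF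
    rintro S ⟨F₁, hF₁, F₂, hF₂, rfl⟩
    exact ⟨F₂, hF₂, fun z hz => hz.2⟩
  obtain ⟨ε, hε, hε'⟩ := he₁ _ h1
  obtain ⟨η, hη, hη'⟩ := he₂ _ h2
  have hε1 : ∀ i, 0 < min (ε i) 1 ∧ min (ε i) 1 ≤ 1 :=
    fun i => ⟨lt_min (hε i) one_pos, min_le_right _ _⟩
  have hη1 : ∀ i, 0 < min (η i) 1 ∧ min (η i) 1 ≤ 1 :=
    fun i => ⟨lt_min (hη i) one_pos, min_le_right _ _⟩
  refine ⟨fun p => min (ε p.1) 1 * min (η p.2) 1,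
    fun p => mul_pos (hε1 p.1).1 (hη1 p.2).1, ?_⟩
  refine polarO_mono (subset_bipolar hPc ⟨_, hε', _, hη', rfl⟩) ?_ ?_
  · refine isClosedIn_coverEnl ?_ ?_ ?_ hF.1 _
    · intro p
      rw [closure_prod_eq]
      exact (hcov₁.compactCl _).prod (hcov₂.compactCl _)
    · intro p
      rw [closure_prod_eq]
      exact prod_mono (hcov₁.clSubset _) (hcov₂.clSubset _)
    · rintro ⟨x, y⟩ ⟨hx, hy⟩
      obtain ⟨s, hs, hsf⟩ := hcov₁.locFin x hx
      obtain ⟨t, ht, htf⟩ := hcov₂.locFin y hy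
      refine ⟨s ×ˢ t, prod_mem_nhds hs ht, (hsf.prod htf).subset ?_⟩
      rintro ⟨i, j⟩ ⟨w, hw1, hw2⟩
      rw [closure_prod_eq] at hw1
      exact ⟨⟨w.1, hw1.1, hw2.1⟩, ⟨w.2, hw1.2, hw2.2⟩⟩
  · refine (coverEnl_mono (D := closureIn U₁ (Prod.fst '' F) ×ˢ closureIn U₂ (Prod.snd '' F))
      ?_ (fun _ => le_rfl)).trans
      ((coverEnl_prod U₁ U₂ Ui Vj _ _ (fun i => min (ε i) 1) (fun j => min (η j) 1)
        hε1 hη1).trans (prod_mono ?_ ?_))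
    · intro z hz
      exact ⟨⟨subset_closure ⟨z, hz, rfl⟩, (hFU hz).1⟩, ⟨subset_closure ⟨z, hz, rfl⟩, (hFU hz).2⟩⟩
    · exact coverEnl_mono subset_rfl fun i => min_le_left _ _
    · exact coverEnl_mono subset_rfl fun i => min_le_left _ _
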